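/- arXiv:2602.11031 — 2 statements merged into one kernel-verified Lean document; each statement's English description precedes it below -/
import Mathlib

section
/- For all β₁, α₂, β₂ ∈ ℤ[1/n] and c₁ ∈ ℤ, the composite endomorphism of BS(1,n) obtained by first applying ψ^{II}_{β₁,c₁} and then applying ψ^I_{α₂,β₂} equals ψ^{II}_{β₁α₂ + μ₁β₂, c₁}, where μ₁ = (n^{c₁} − 1)/(n − 1) ∈ ℤ[1/n]. -/
/-- The defining relator set of the Baumslag–Solitar group `BS(1,n)`:
generators `false ↦ a`, `true ↦ t`, relator `t⁻¹ aⁿ t a⁻¹`. -/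
def bsRels (n : ℤ) : Set (FreeGroup Bool) :=
  {(FreeGroup.of true)⁻¹ * (FreeGroup.of false) ^ n * FreeGroup.of true * (FreeGroup.of false)⁻¹}

/-- The solvable Baumslag–Solitar group `BS(1,n) = ⟨a, t ∣ t⁻¹ aⁿ t = a⟩`. -/
abbrev BS (n : ℤ) := PresentedGroup (bsRels n)

/-- The generator `a` of `BS(1,n)`. -/
def BS.a (n : ℤ) : BS n := PresentedGroup.of false

/-- The generator `t` of `BS(1,n)`. -/
def BS.t (n : ℤ) : BS n := PresentedGroup.of true

/-- `ℤ[1/n]` as a set of rationals: those of the form `k / n^p`. -/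
def zInv (n : ℤ) : Set ℚ := {x : ℚ | ∃ (k : ℤ) (p : ℕ), x = (k : ℚ) / (n : ℚ) ^ p}

open Classical in
/-- For `α = k/n^p ∈ ℤ[1/n]`, the element `a^α := t⁻ᵖ aᵏ tᵖ` of `BS(1,n)`
(junk value `1` if `α ∉ ℤ[1/n]`). -/
noncomputable def apow (n : ℤ) (α : ℚ) : BS n :=
  if h : ∃ kp : ℤ × ℕ, α = (kp.1 : ℚ) / (n : ℚ) ^ kp.2 then
    BS.t n ^ (-(h.choose.2 : ℤ)) * BS.a n ^ h.choose.1 * BS.t n ^ (h.choose.2 : ℤ)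
  else 1

/-- `u` and `v` are `ψ`-twisted conjugate: `v = ψ(x)⁻¹ u x` for some `x`. -/
def twistedConj {G : Type*} [Group G] (ψ : G →* G) (u v : G) : Prop :=
  ∃ x : G, v = (ψ x)⁻¹ * u * x

section zInv

variable {n : ℤ} {x y : ℚ}

theorem zInv_add (hn : n ≠ 0) (hx : x ∈ zInv n) (hy : y ∈ zInv n) : x + y ∈ zInv n := by
  obtain ⟨k, p, rfl⟩ := hx
  obtain ⟨l, q, rfl⟩ := hy
  have hn' : (n : ℚ) ≠ 0 := Int.cast_ne_zero.mpr hn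
  refine ⟨k * n ^ q + l * n ^ p, p + q, ?_⟩
  push_cast
  rw [pow_add]
  field_simp

theorem zInv_mul (hx : x ∈ zInv n) (hy : y ∈ zInv n) : x * y ∈ zInv n := by
  obtain ⟨k, p, rfl⟩ := hx
  obtain ⟨l, q, rfl⟩ := hy
  refine ⟨k * l, p + q, ?_⟩
  push_cast
  rw [div_mul_div_comm, pow_add]

theorem zInv_intCast (k : ℤ) : (k : ℚ) ∈ zInv n := ⟨k, 0, by simp⟩

theorem zInv_neg (hx : x ∈ zInv n) : -x ∈ zInv n := by
  simpa using zInv_mul (zInv_intCast (-1)) hx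

theorem zInv_zpow (c : ℤ) : (n : ℚ) ^ c ∈ zInv n := by
  obtain ⟨m, rfl | rfl⟩ := c.eq_nat_or_neg
  · exact ⟨n ^ m, 0, by simp⟩
  · exact ⟨1, m, by simp⟩

end zInv

section geometric

variable {n : ℤ}

theorem geom_quotient_add_one (h0 : (n : ℚ) ≠ 0) (h1 : (n : ℚ) - 1 ≠ 0) (c : ℤ) :
    ((n : ℚ) ^ (c + 1) - 1) / ((n : ℚ) - 1) =
      ((n : ℚ) ^ c - 1) / ((n : ℚ) - 1) + (n : ℚ) ^ c := by
  rw [zpow_add_one₀ h0]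
  field_simp
  ring

theorem geom_quotient_sub_one (h0 : (n : ℚ) ≠ 0) (h1 : (n : ℚ) - 1 ≠ 0) (c : ℤ) :
    ((n : ℚ) ^ (c - 1) - 1) / ((n : ℚ) - 1) =
      ((n : ℚ) ^ c - 1) / ((n : ℚ) - 1) + -(n : ℚ) ^ (c - 1) := by
  have h := geom_quotient_add_one h0 h1 (c - 1)
  rw [sub_add_cancel] at h
  rw [h, add_neg_cancel_right]

theorem geom_quotient_mem_zInv (h0 : (n : ℚ) ≠ 0) (h1 : (n : ℚ) - 1 ≠ 0) (c : ℤ) :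
    ((n : ℚ) ^ c - 1) / ((n : ℚ) - 1) ∈ zInv n := by
  have hn : n ≠ 0 := Int.cast_ne_zero.mp h0
  induction c using Int.induction_on with
  | zero => simpa using zInv_intCast (n := n) 0
  | succ i ih =>
    rw [geom_quotient_add_one h0 h1]
    exact zInv_add hn ih (zInv_zpow _)
  | pred i ih =>
    rw [geom_quotient_sub_one h0 h1]
    exact zInv_add hn ih (zInv_neg (zInv_zpow _))

end geometric

section BaumslagSolitar

variable {n : ℤ}

theorem BS.t_mul_a_mul_t_inv : BS.t n * BS.a n * (BS.t n)⁻¹ = BS.a n ^ n := by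
  have h : (BS.t n)⁻¹ * BS.a n ^ n * BS.t n * (BS.a n)⁻¹ = 1 :=
    PresentedGroup.one_of_mem (rels := bsRels n) rfl
  nth_rw 1 [← mul_inv_eq_one.mp h]
  group

theorem BS.t_pow_mul_a_zpow (m : ℕ) (k : ℤ) :
    BS.t n ^ m * BS.a n ^ k * (BS.t n ^ m)⁻¹ = BS.a n ^ (n ^ m * k) := by
  induction m generalizing k with
  | zero => simp
  | succ m ih =>
    calc BS.t n ^ (m + 1) * BS.a n ^ k * (BS.t n ^ (m + 1))⁻¹
        = BS.t n ^ m * (BS.t n * BS.a n ^ k * (BS.t n)⁻¹) * (BS.t n ^ m)⁻¹ := by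
          rw [pow_succ]; group
      _ = BS.a n ^ (n ^ (m + 1) * k) := by
          rw [← conj_zpow, BS.t_mul_a_mul_t_inv, ← zpow_mul, ih, pow_succ, mul_assoc]

theorem BS.conj_a_eq_of_mul_eq {k l : ℤ} {p q : ℕ} (h : k * n ^ q = l * n ^ p) :
    (BS.t n ^ p)⁻¹ * BS.a n ^ k * BS.t n ^ p = (BS.t n ^ q)⁻¹ * BS.a n ^ l * BS.t n ^ q := by
  have key : BS.t n ^ q * BS.a n ^ k * (BS.t n ^ q)⁻¹ =
      BS.t n ^ p * BS.a n ^ l * (BS.t n ^ p)⁻¹ := by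
    rw [BS.t_pow_mul_a_zpow, BS.t_pow_mul_a_zpow, mul_comm, h, mul_comm]
  have comm : BS.t n ^ p * BS.t n ^ q = BS.t n ^ q * BS.t n ^ p := pow_mul_comm _ _ _
  calc (BS.t n ^ p)⁻¹ * BS.a n ^ k * BS.t n ^ p
      = (BS.t n ^ q * BS.t n ^ p)⁻¹ * (BS.t n ^ q * BS.a n ^ k * (BS.t n ^ q)⁻¹) *
          (BS.t n ^ q * BS.t n ^ p) := by group
    _ = (BS.t n ^ q)⁻¹ * BS.a n ^ l * BS.t n ^ q := by
        rw [key, ← comm]; group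

theorem apow_div_pow (hn : n ≠ 0) (k : ℤ) (p : ℕ) :
    apow n ((k : ℚ) / (n : ℚ) ^ p) = (BS.t n ^ p)⁻¹ * BS.a n ^ k * BS.t n ^ p := by
  have hn' : (n : ℚ) ≠ 0 := Int.cast_ne_zero.mpr hn
  have h : ∃ kp : ℤ × ℕ, (k : ℚ) / (n : ℚ) ^ p = (kp.1 : ℚ) / (n : ℚ) ^ kp.2 := ⟨(k, p), rfl⟩
  rw [apow, dif_pos h, zpow_neg, zpow_natCast]
  have hs := h.choose_spec
  rw [div_eq_div_iff (pow_ne_zero _ hn') (pow_ne_zero _ hn')] at hs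
  exact (BS.conj_a_eq_of_mul_eq (mod_cast hs)).symm

theorem apow_zero (hn : n ≠ 0) : apow n 0 = 1 := by
  simpa using apow_div_pow hn 0 0

theorem apow_add (hn : n ≠ 0) {x y : ℚ} (hx : x ∈ zInv n) (hy : y ∈ zInv n) :
    apow n (x + y) = apow n x * apow n y := by
  have hn' : (n : ℚ) ≠ 0 := Int.cast_ne_zero.mpr hn
  obtain ⟨k, p, rfl⟩ := hx
  obtain ⟨l, q, rfl⟩ := hy
  have h₁ : (k : ℚ) / (n : ℚ) ^ p = ((k * n ^ q : ℤ) : ℚ) / (n : ℚ) ^ (p + q) := by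
    push_cast; rw [pow_add]; field_simp
  have h₂ : (l : ℚ) / (n : ℚ) ^ q = ((l * n ^ p : ℤ) : ℚ) / (n : ℚ) ^ (p + q) := by
    push_cast; rw [pow_add]; field_simp
  rw [h₁, h₂, ← add_div, ← Int.cast_add]
  simp only [apow_div_pow hn]
  group

theorem apow_neg (hn : n ≠ 0) {x : ℚ} (hx : x ∈ zInv n) : apow n (-x) = (apow n x)⁻¹ := by
  rw [eq_inv_iff_mul_eq_one, ← apow_add hn (zInv_neg hx) hx, neg_add_cancel, apow_zero hn]

theorem apow_commute (hn : n ≠ 0) {x y : ℚ} (hx : x ∈ zInv n) (hy : y ∈ zInv n) :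
    Commute (apow n x) (apow n y) := by
  rw [commute_iff_eq, ← apow_add hn hx hy, add_comm, apow_add hn hy hx]

theorem apow_zpow (hn : n ≠ 0) {x : ℚ} (hx : x ∈ zInv n) (k : ℤ) :
    apow n x ^ k = apow n (k * x) := by
  obtain ⟨l, p, rfl⟩ := hx
  have h : (k : ℚ) * ((l : ℚ) / (n : ℚ) ^ p) = ((l * k : ℤ) : ℚ) / (n : ℚ) ^ p := by
    push_cast; ring
  have hconj := conj_zpow (i := k) (a := (BS.t n ^ p)⁻¹) (b := BS.a n ^ l)
  rw [inv_inv] at hconj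
  rw [h, apow_div_pow hn, apow_div_pow hn, hconj, zpow_mul]

theorem t_inv_conj_apow (hn : n ≠ 0) {x : ℚ} (hx : x ∈ zInv n) :
    (BS.t n)⁻¹ * apow n x * BS.t n = apow n ((n : ℚ)⁻¹ * x) := by
  have hn' : (n : ℚ) ≠ 0 := Int.cast_ne_zero.mpr hn
  obtain ⟨k, p, rfl⟩ := hx
  have h : (n : ℚ)⁻¹ * ((k : ℚ) / (n : ℚ) ^ p) = (k : ℚ) / (n : ℚ) ^ (p + 1) := by
    rw [pow_succ]; field_simp
  rw [h, apow_div_pow hn, apow_div_pow hn, pow_succ]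
  group

theorem t_conj_apow (hn : n ≠ 0) {x : ℚ} (hx : x ∈ zInv n) :
    BS.t n * apow n x * (BS.t n)⁻¹ = apow n ((n : ℚ) * x) := by
  have hn' : (n : ℚ) ≠ 0 := Int.cast_ne_zero.mpr hn
  have h := t_inv_conj_apow hn (zInv_mul (zInv_intCast n) hx)
  rw [inv_mul_cancel_left₀ hn'] at h
  rw [← h]
  group

theorem t_zpow_conj_apow (hn : n ≠ 0) {x : ℚ} (hx : x ∈ zInv n) (c : ℤ) :
    BS.t n ^ c * apow n x * (BS.t n ^ c)⁻¹ = apow n ((n : ℚ) ^ c * x) := by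
  have hn' : (n : ℚ) ≠ 0 := Int.cast_ne_zero.mpr hn
  induction c using Int.induction_on with
  | zero => simp
  | succ i ih =>
    rw [add_comm, zpow_add₀ hn', zpow_one, mul_assoc (n : ℚ),
      ← t_conj_apow hn (zInv_mul (zInv_zpow _) hx), ← ih]
    group
  | pred i ih =>
    rw [sub_eq_neg_add, zpow_add₀ hn', zpow_neg_one, mul_assoc (n : ℚ)⁻¹,
      ← t_inv_conj_apow hn (zInv_mul (zInv_zpow _) hx), ← ih]
    group

theorem apow_mul_t_zpow (h0 : (n : ℚ) ≠ 0) (h1 : (n : ℚ) - 1 ≠ 0) {β : ℚ} (hβ : β ∈ zInv n)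
    (c : ℤ) :
    (apow n β * BS.t n) ^ c =
      apow n (((n : ℚ) ^ c - 1) / ((n : ℚ) - 1) * β) * BS.t n ^ c := by
  have hn : n ≠ 0 := Int.cast_ne_zero.mp h0
  have hμ (c : ℤ) := zInv_mul (geom_quotient_mem_zInv h0 h1 c) hβ
  induction c using Int.induction_on with
  | zero => simp [apow_zero hn]
  | succ i ih =>
    rw [zpow_add_one, ih, geom_quotient_add_one h0 h1, add_mul,
      apow_add hn (hμ _) (zInv_mul (zInv_zpow _) hβ), ← t_zpow_conj_apow hn hβ]
    group
  | pred i ih =>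
    rw [zpow_sub_one, ih, geom_quotient_sub_one h0 h1, add_mul, neg_mul,
      apow_add hn (hμ _) (zInv_neg (zInv_mul (zInv_zpow _) hβ)),
      apow_neg hn (zInv_mul (zInv_zpow _) hβ), ← t_zpow_conj_apow hn hβ]
    group

theorem apow_mul_t_zpow_conj_apow (h0 : (n : ℚ) ≠ 0) (h1 : (n : ℚ) - 1 ≠ 0) {β x : ℚ}
    (hβ : β ∈ zInv n) (hx : x ∈ zInv n) (c : ℤ) :
    (apow n β * BS.t n) ^ c * apow n x * ((apow n β * BS.t n) ^ c)⁻¹ =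
      apow n ((n : ℚ) ^ c * x) := by
  have hn : n ≠ 0 := Int.cast_ne_zero.mp h0
  have hcomm := apow_commute hn (zInv_mul (geom_quotient_mem_zInv h0 h1 c) hβ)
    (zInv_mul (zInv_zpow c) hx)
  rw [apow_mul_t_zpow h0 h1 hβ]
  generalize apow n (((n : ℚ) ^ c - 1) / ((n : ℚ) - 1) * β) = w at *
  calc w * BS.t n ^ c * apow n x * (w * BS.t n ^ c)⁻¹
      = w * (BS.t n ^ c * apow n x * (BS.t n ^ c)⁻¹) * w⁻¹ := by group
    _ = apow n ((n : ℚ) ^ c * x) := by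
        rw [t_zpow_conj_apow hn hx, hcomm.eq, mul_inv_cancel_right]

theorem typeI_apow (h0 : (n : ℚ) ≠ 0) (h1 : (n : ℚ) - 1 ≠ 0) {α β x : ℚ}
    (hα : α ∈ zInv n) (hβ : β ∈ zInv n) (hx : x ∈ zInv n) (ψ : BS n →* BS n)
    (ha : ψ (BS.a n) = apow n α) (ht : ψ (BS.t n) = apow n β * BS.t n) :
    ψ (apow n x) = apow n (x * α) := by
  have hn : n ≠ 0 := Int.cast_ne_zero.mp h0
  obtain ⟨k, p, rfl⟩ := hx
  have h := apow_mul_t_zpow_conj_apow h0 h1 hβ (zInv_mul (zInv_intCast k) hα) (-p)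
  rw [zpow_neg, zpow_natCast, inv_inv] at h
  rw [apow_div_pow hn, map_mul, map_mul, map_inv, map_pow, map_zpow, ha, ht, apow_zpow hn hα, h,
    zpow_neg, zpow_natCast]
  congr 1
  ring

end BaumslagSolitar

/-- the composite of ψ^{II}_{β₁,c₁} followed by ψ^I_{α₂,β₂} is
ψ^{II}_{β₁α₂ + μ₁β₂, c₁} where μ₁ = (n^{c₁}−1)/(n−1) ∈ ℤ[1/n]. -/
theorem comp_typeII_typeI (n : ℤ) (hn : n ∉ ({0, 1, -1} : Set ℤ))
    (β₁ α₂ β₂ : ℚ) (hβ₁ : β₁ ∈ zInv n) (hα₂ : α₂ ∈ zInv n) (hβ₂ : β₂ ∈ zInv n)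
    (c₁ : ℤ)
    (ψ₁ ψ₂ : BS n →* BS n)
    (h₁a : ψ₁ (BS.a n) = 1) (h₁t : ψ₁ (BS.t n) = apow n β₁ * BS.t n ^ c₁)
    (h₂a : ψ₂ (BS.a n) = apow n α₂) (h₂t : ψ₂ (BS.t n) = apow n β₂ * BS.t n) :
    ((n : ℚ) ^ c₁ - 1) / ((n : ℚ) - 1) ∈ zInv n ∧
    (ψ₂.comp ψ₁) (BS.a n) = 1 ∧
    (ψ₂.comp ψ₁) (BS.t n) =
      apow n (β₁ * α₂ + ((n : ℚ) ^ c₁ - 1) / ((n : ℚ) - 1) * β₂) * BS.t n ^ c₁ := by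
  obtain ⟨hn0, hn1, -⟩ : n ≠ 0 ∧ n ≠ 1 ∧ n ≠ -1 := by simpa using hn
  have h0 : (n : ℚ) ≠ 0 := Int.cast_ne_zero.mpr hn0
  have h1 : (n : ℚ) - 1 ≠ 0 := sub_ne_zero.mpr (mod_cast hn1)
  have hμ := geom_quotient_mem_zInv h0 h1 c₁
  refine ⟨hμ, by simp [h₁a], ?_⟩
  rw [MonoidHom.comp_apply, h₁t, map_mul, map_zpow, h₂t,
    typeI_apow h0 h1 hα₂ hβ₂ hβ₁ ψ₂ h₂a h₂t, apow_mul_t_zpow h0 h1 hβ₂,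
    apow_add hn0 (zInv_mul hβ₁ hα₂) (zInv_mul hμ hβ₂), mul_assoc]
end

section
/- Let β ∈ ℤ[1/n], c ∈ ℤ with c ≠ 0, m₁, m₂, r, d ∈ ℤ with r ≥ 0. Then the elements a^{m₁} and a^{m₂/n^r} t^d of BS(1,n) are ψ^{II}_{β,c}-twisted conjugate if and only if there exist p ∈ ℤ and γ ∈ ℤ[1/n] such that d = p − pc and m₂/n^r = ( ((1 − n^{pc})/(n^c − 1))·β + m₁ + γ ) · n^{−pc}. -/
namespace BS

theorem t_mul_a_pow (n : ℤ) : t n * a n = a n ^ n * t n := by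
  have h : (t n)⁻¹ * a n ^ n * t n * (a n)⁻¹ = 1 :=
    PresentedGroup.one_of_mem (rels := bsRels n) (Set.mem_singleton _)
  have h' : (t n)⁻¹ * a n ^ n * t n = a n := mul_inv_eq_one.mp h
  calc t n * a n = t n * ((t n)⁻¹ * a n ^ n * t n) := by rw [h']
    _ = a n ^ n * t n := by group

theorem t_pow_mul_a_zpow_s17 (n : ℤ) (s : ℕ) (k : ℤ) :
    t n ^ s * a n ^ k = a n ^ (n ^ s * k) * t n ^ s := by
  have h₁ : SemiconjBy (t n) (a n) (a n ^ n) := t_mul_a_pow n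
  have h : SemiconjBy (t n ^ s) (a n) (a n ^ n ^ s) := by
    induction s with
    | zero => simp
    | succ s ih =>
      have h₂ := (h₁.zpow_right (n ^ s)).mul_left ih
      rwa [← zpow_mul, ← pow_succ', ← pow_succ'] at h₂
  have h₃ := h.zpow_right k
  rwa [← zpow_mul] at h₃

theorem exists_normal_form (n : ℤ) (x : BS n) :
    ∃ (p q : ℕ) (k : ℤ), x = (t n ^ p)⁻¹ * a n ^ k * t n ^ q := by
  induction x using PresentedGroup.induction_on with
  | _ z =>
  induction z using FreeGroup.induction_on with
  | C1 => exact ⟨0, 0, 0, by simp⟩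
  | of b =>
    cases b
    · exact ⟨0, 0, 1, by simp; rfl⟩
    · exact ⟨0, 1, 0, by simp; rfl⟩
  | inv_of b ih =>
    obtain ⟨p, q, k, h⟩ := ih
    refine ⟨q, p, -k, ?_⟩
    rw [map_inv, h]
    group
  | mul y z ihy ihz =>
    obtain ⟨p, q, k, hy⟩ := ihy
    obtain ⟨p', q', k', hz⟩ := ihz
    rw [map_mul, hy, hz]
    rcases le_total p' q with h | h
    · obtain ⟨s, rfl⟩ := Nat.exists_eq_add_of_le' h
      refine ⟨p, s + q', k + n ^ s * k', ?_⟩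
      calc (t n ^ p)⁻¹ * a n ^ k * t n ^ (s + p') * ((t n ^ p')⁻¹ * a n ^ k' * t n ^ q')
          = (t n ^ p)⁻¹ * a n ^ k * (t n ^ s * a n ^ k') * t n ^ q' := by
            rw [pow_add]; group
        _ = _ := by rw [t_pow_mul_a_zpow_s17, zpow_add, pow_add]; simp only [mul_assoc]
    · obtain ⟨s, rfl⟩ := Nat.exists_eq_add_of_le' h
      refine ⟨s + p, q', n ^ s * k + k', ?_⟩
      have h' : a n ^ k * (t n ^ s)⁻¹ = (t n ^ s)⁻¹ * a n ^ (n ^ s * k) := by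
        rw [mul_inv_eq_iff_eq_mul, mul_assoc, ← t_pow_mul_a_zpow_s17, inv_mul_cancel_left]
      calc (t n ^ p)⁻¹ * a n ^ k * t n ^ q * ((t n ^ (s + q))⁻¹ * a n ^ k' * t n ^ q')
          = (t n ^ p)⁻¹ * (a n ^ k * (t n ^ s)⁻¹) * a n ^ k' * t n ^ q' := by
            rw [pow_add]; group
        _ = _ := by rw [h', zpow_add, pow_add, mul_inv_rev]; simp only [mul_assoc]

/-- The action of `BS(1,n)` on `ℚ` by affine maps: `a` acts by `y ↦ y + 1` and `t` by
`y ↦ n * y`. -/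
def toPerm (n : ℤ) (hn : (n : ℚ) ≠ 0) : BS n →* Equiv.Perm ℚ :=
  PresentedGroup.toGroup
    (f := fun b => if b then Equiv.mulLeft₀ (n : ℚ) hn else Equiv.addRight (1 : ℚ)) (by
    rintro _ rfl
    simp only [map_mul, map_inv, map_zpow, FreeGroup.lift_apply_of, if_true]
    rw [mul_inv_eq_one, mul_assoc, inv_mul_eq_iff_eq_mul]
    ext y
    simp [mul_add])

variable {n : ℤ} (hn : (n : ℚ) ≠ 0)

theorem toPerm_a (y : ℚ) : toPerm n hn (a n) y = y + 1 := by
  simp [toPerm, a]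

theorem toPerm_t (y : ℚ) : toPerm n hn (t n) y = n * y := by
  simp [toPerm, t]

theorem toPerm_a_zpow (k : ℤ) (y : ℚ) : toPerm n hn (a n ^ k) y = y + k := by
  have h : toPerm n hn (a n) = Equiv.addRight (1 : ℚ) := Equiv.ext (toPerm_a hn)
  simp [h]

theorem zpow_apply_eq {K : Type*} [Field K] {σ : Equiv.Perm K} {u f : K} (hu : u ≠ 0)
    (h : ∀ y, σ y = u * (y - f) + f) (k : ℤ) (y : K) : (σ ^ k) y = u ^ k * (y - f) + f := by
  induction k generalizing y with
  | zero => simp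
  | succ k ih => rw [zpow_add_one, Equiv.Perm.mul_apply, ih, h, zpow_add_one₀ hu]; ring
  | pred k ih =>
    have h' : σ⁻¹ y = u⁻¹ * (y - f) + f := by
      rw [Equiv.Perm.inv_eq_iff_eq, h]; field_simp; ring
    rw [zpow_sub_one, Equiv.Perm.mul_apply, h', ih, zpow_sub_one₀ hu]; ring

theorem toPerm_t_zpow (k : ℤ) (y : ℚ) : toPerm n hn (t n ^ k) y = (n : ℚ) ^ k * y := by
  rw [map_zpow, zpow_apply_eq (f := 0) hn (by simp [toPerm_t])]
  simp

theorem toPerm_normal_form (p q k : ℤ) (y : ℚ) :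
    toPerm n hn (t n ^ (-p) * a n ^ k * t n ^ q) y
      = (n : ℚ) ^ (q - p) * y + k / (n : ℚ) ^ p := by
  rw [map_mul, map_mul, Equiv.Perm.mul_apply, Equiv.Perm.mul_apply, toPerm_t_zpow,
    toPerm_t_zpow, toPerm_a_zpow, zpow_sub₀ hn, zpow_neg]
  field_simp

theorem toPerm_apow {α : ℚ} (hα : α ∈ zInv n) (y : ℚ) : toPerm n hn (apow n α) y = y + α := by
  obtain ⟨k, p, hkp⟩ := hα
  have h : ∃ kp : ℤ × ℕ, α = (kp.1 : ℚ) / (n : ℚ) ^ kp.2 := ⟨(k, p), hkp⟩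
  rw [apow, dif_pos h, toPerm_normal_form, zpow_natCast, ← h.choose_spec]
  simp

theorem zpow_right_injective (hn' : n ∉ ({0, 1, -1} : Set ℤ)) :
    Function.Injective fun k : ℤ => (n : ℚ) ^ k := by
  simp only [Set.mem_insert_iff, Set.mem_singleton_iff, not_or] at hn'
  have h : (1 : ℚ) < |(n : ℚ)| := by
    have : 1 < |n| := by grind
    exact_mod_cast this
  intro k l hkl
  have hkl' := congrArg abs hkl
  simp only [abs_zpow] at hkl'
  exact zpow_right_injective₀ (by linarith) h.ne' hkl'

theorem toPerm_injective (hn' : n ∉ ({0, 1, -1} : Set ℤ)) :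
    Function.Injective (toPerm n hn) := by
  rw [injective_iff_map_eq_one]
  intro x hx
  obtain ⟨p, q, k, rfl⟩ := exists_normal_form n x
  have h (y : ℚ) : (n : ℚ) ^ ((q : ℤ) - p) * y + k / (n : ℚ) ^ (p : ℤ) = y := by
    rw [← toPerm_normal_form hn, zpow_neg, zpow_natCast, zpow_natCast, hx, Equiv.Perm.one_apply]
  have hk : k = 0 := by
    have h₀ := h 0
    simpa [hn] using h₀
  subst hk
  have h₁ := h 1
  have hpq : (q : ℤ) - p = 0 := zpow_right_injective hn' (by simpa using h₁)
  obtain rfl : q = p := by omega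
  simp

variable {β : ℚ} {c : ℤ} {ψ : BS n →* BS n}

/-- The image of `x` under a type-II endomorphism acts as a power of the homothety
`y ↦ n ^ c * y + β`, written around its fixed point. -/
theorem toPerm_typeII (hβ : β ∈ zInv n) (hc : (n : ℚ) ^ c - 1 ≠ 0) (ha : ψ (a n) = 1)
    (ht : ψ (t n) = apow n β * t n ^ c) (p q k : ℤ) (y : ℚ) :
    toPerm n hn (ψ (t n ^ (-p) * a n ^ k * t n ^ q)) y
      = (n : ℚ) ^ ((q - p) * c) * (y + β / ((n : ℚ) ^ c - 1)) - β / ((n : ℚ) ^ c - 1) := by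
  have h : ψ (t n ^ (-p) * a n ^ k * t n ^ q) = ψ (t n) ^ (q - p) := by
    simp only [map_mul, map_zpow, ha]
    group
  have hσ (y : ℚ) : toPerm n hn (ψ (t n)) y
      = (n : ℚ) ^ c * (y - -(β / ((n : ℚ) ^ c - 1))) + -(β / ((n : ℚ) ^ c - 1)) := by
    rw [ht, map_mul, Equiv.Perm.mul_apply, toPerm_apow hn hβ, toPerm_t_zpow]
    field_simp
    ring
  rw [h, map_zpow, zpow_apply_eq (zpow_ne_zero c hn) hσ, ← zpow_mul, mul_comm c]
  ring

end BS

/-- a^{m₁} and a^{m₂/n^r} t^d are ψ^{II}_{β,c}-twisted conjugate (c ≠ 0)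
iff there exist p ∈ ℤ and γ ∈ ℤ[1/n] with d = p − pc and
m₂/n^r = (((1 − n^{pc})/(n^c − 1))·β + m₁ + γ)·n^{−pc}. -/
theorem typeII_twistedConj_iff (n : ℤ) (hn : n ∉ ({0, 1, -1} : Set ℤ))
    (β : ℚ) (hβ : β ∈ zInv n) (c : ℤ) (hc : c ≠ 0)
    (m₁ m₂ d : ℤ) (r : ℕ)
    (ψ : BS n →* BS n)
    (ha : ψ (BS.a n) = 1) (ht : ψ (BS.t n) = apow n β * BS.t n ^ c) :
    twistedConj ψ (BS.a n ^ m₁) (apow n ((m₂ : ℚ) / (n : ℚ) ^ r) * BS.t n ^ d) ↔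
    ∃ (p : ℤ), ∃ γ ∈ zInv n,
      d = p - p * c ∧
      (m₂ : ℚ) / (n : ℚ) ^ r =
        ((1 - (n : ℚ) ^ (p * c)) / ((n : ℚ) ^ c - 1) * β + (m₁ : ℚ) + γ)
          * (n : ℚ) ^ (-(p * c)) := by
  have hn0 : (n : ℚ) ≠ 0 := by
    rintro h
    simp [Int.cast_eq_zero.mp h] at hn
  have hc1 : (n : ℚ) ^ c - 1 ≠ 0 := fun h =>
    hc (BS.zpow_right_injective hn (by simpa using sub_eq_zero.mp h))
  have hv (y : ℚ) : BS.toPerm n hn0 (apow n ((m₂ : ℚ) / (n : ℚ) ^ r) * BS.t n ^ d) y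
      = (n : ℚ) ^ d * y + (m₂ : ℚ) / (n : ℚ) ^ r := by
    rw [map_mul, Equiv.Perm.mul_apply, BS.toPerm_apow hn0 ⟨m₂, r, rfl⟩, BS.toPerm_t_zpow]
  have key (p q k : ℤ) : apow n ((m₂ : ℚ) / (n : ℚ) ^ r) * BS.t n ^ d
        = (ψ (BS.t n ^ (-p) * BS.a n ^ k * BS.t n ^ q))⁻¹ * BS.a n ^ m₁
          * (BS.t n ^ (-p) * BS.a n ^ k * BS.t n ^ q) ↔
      ∀ y : ℚ, (n : ℚ) ^ ((q - p) * c) * ((n : ℚ) ^ d * y + (m₂ : ℚ) / (n : ℚ) ^ r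
          + β / ((n : ℚ) ^ c - 1)) - β / ((n : ℚ) ^ c - 1)
        = (n : ℚ) ^ (q - p) * y + k / (n : ℚ) ^ p + m₁ := by
    rw [mul_assoc, eq_inv_mul_iff_mul_eq, ← (BS.toPerm_injective hn0 hn).eq_iff, Equiv.ext_iff]
    refine forall_congr' fun y => ?_
    rw [map_mul, Equiv.Perm.mul_apply, hv, BS.toPerm_typeII hn0 hβ hc1 ha ht,
      map_mul _ (BS.a n ^ m₁), Equiv.Perm.mul_apply, BS.toPerm_normal_form, BS.toPerm_a_zpow]
  constructor
  · rintro ⟨x, hx⟩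
    obtain ⟨p, q, k, rfl⟩ := BS.exists_normal_form n x
    rw [← zpow_natCast (BS.t n), ← zpow_natCast (BS.t n), ← zpow_neg, key] at hx
    have h₀ := hx 0
    have h₁ := hx 1
    refine ⟨q - p, k / (n : ℚ) ^ p, ⟨k, p, rfl⟩, ?_, ?_⟩
    · have h : ((q : ℤ) - p) * c + d = q - p := BS.zpow_right_injective hn (by
        simp only [zpow_add₀ hn0]
        linear_combination h₁ - h₀)
      linarith
    · rw [zpow_natCast] at h₀
      rw [zpow_neg, eq_mul_inv_iff_mul_eq₀ (zpow_ne_zero _ hn0)]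
      linear_combination h₀
  · rintro ⟨p, γ, ⟨k, s, rfl⟩, hd, hm⟩
    refine ⟨BS.t n ^ (-(s : ℤ)) * BS.a n ^ k * BS.t n ^ (s + p), (key s (s + p) k).mpr ?_⟩
    intro y
    rw [zpow_neg, eq_mul_inv_iff_mul_eq₀ (zpow_ne_zero _ hn0)] at hm
    have h : (n : ℚ) ^ (p * c) * (n : ℚ) ^ d = (n : ℚ) ^ p := by
      rw [← zpow_add₀ hn0, hd, add_sub_cancel]
    rw [add_sub_cancel_left, zpow_natCast]
    linear_combination hm + y * h
end
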